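/- Let X : Ω → 𝒳 have countable range, Z, C, R : Ω → {0,1}, Y₁, Y₀ integrable real random variables, and Y := Z·Y₁ + (1 − Z)·Y₀ (consistency). Fix c ∈ {0,1} with P(C=c) > 0 and assume, for every x ∈ 𝒳 with P(X=x) > 0: (i) under P(· | X=x) the triple (Y₁, Y₀, C) is independent of Z, and 0 < P(Z=1 | X=x) < 1 (treatment assignment ignorability and positivity); (ii) for every z, c' ∈ {0,1} with P({X=x} ∩ {Z=z} ∩ {C=c'}) > 0, under P(· | {X=x} ∩ {Z=z} ∩ {C=c'}) the random variables R and Y are independent and P(R=1 | {X=x} ∩ {Z=z} ∩ {C=c'}) > 0 (latent missing at random and response positivity); and (iii) if P({X=x} ∩ {Z=0} ∩ {C=c'}) > 0 for both c' ∈ {0,1}, then E[Y | {X=x} ∩ {Z=0} ∩ {C=1}] = E[Y | {X=x} ∩ {Z=0} ∩ {C=0}] (principal ignorability). Then, writing π_c(x) := P(C=c | {X=x} ∩ {Z=1}), μ₁c(x) := E[Y | {X=x} ∩ {Z=1} ∩ {C=c} ∩ {R=1}], and κ₀(x) := E[Y | {X=x} ∩ {Z=0} ∩ {R=1}], the principal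 causal effect satisfies E[Y₁ − Y₀ | C=c] = ( Σ_{x: P({X=x} ∩ {C=c}) > 0} π_c(x)·(μ₁c(x) − κ₀(x))·P(X=x) ) / ( Σ_{x: P(X=x) > 0} π_c(x)·P(X=x) ). -/

import Mathlib

open MeasureTheory ProbabilityTheory
open scoped Classical

/-- Conditional probability of `A` given `B`: `P(A | B) := P(A ∩ B) / P(B)`. -/
noncomputable def cPr {Ω : Type*} [MeasurableSpace Ω] (P : Measure Ω) (A B : Set Ω) : ℝ :=
  (P (A ∩ B)).toReal / (P B).toReal

/-- Conditional expectation of `W` given event `B`: `E[W | B] := E[W·1_B] / P(B)`. -/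
noncomputable def cExp {Ω : Type*} [MeasurableSpace Ω] (P : Measure Ω) (W : Ω → ℝ) (B : Set Ω) : ℝ :=
  (∫ ω in B, W ω ∂P) / (P B).toReal

section Conditioning

variable {Ω β : Type*} [MeasurableSpace Ω] [MeasurableSpace β]

lemma hasSum_setIntegral_inter_preimage [Countable β] [MeasurableSingletonClass β]
    {μ : Measure Ω} {f : Ω → ℝ} {g : Ω → β} {S : Set Ω}
    (hg : Measurable g) (hS : MeasurableSet S) (hf : Integrable f μ) :
    HasSum (fun b => ∫ ω in S ∩ g ⁻¹' {b}, f ω ∂μ) (∫ ω in S, f ω ∂μ) := by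
  have hU : S = ⋃ b, S ∩ g ⁻¹' {b} := by
    ext ω
    simp
  have h := hasSum_integral_iUnion (μ := μ) (f := f) (s := fun b => S ∩ g ⁻¹' {b})
    (fun b => hS.inter (hg (measurableSet_singleton b)))
    (fun a b hab => Set.disjoint_left.2 fun ω ha hb => hab (ha.2.symm.trans hb.2))
    hf.integrableOn
  rwa [← hU] at h

lemma hasSum_measure_inter_preimage [Countable β] [MeasurableSingletonClass β]
    {μ : Measure Ω} [IsFiniteMeasure μ] {g : Ω → β} {S : Set Ω}
    (hg : Measurable g) (hS : MeasurableSet S) :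
    HasSum (fun b => (μ (S ∩ g ⁻¹' {b})).toReal) (μ S).toReal := by
  simpa [Measure.real] using
    hasSum_setIntegral_inter_preimage (f := fun _ => (1 : ℝ)) hg hS (integrable_const (μ := μ) 1)

lemma ProbabilityTheory.IndepFun.setIntegral_inter_preimage_mul
    {μ : Measure Ω} [IsFiniteMeasure μ] {f : Ω → ℝ} {g : Ω → β} {A : Set Ω} {B : Set β}
    (h : IndepFun f g (μ[|A])) (hf : Measurable f) (hg : Measurable g)
    (hB : MeasurableSet B) :
    (∫ ω in A ∩ g ⁻¹' B, f ω ∂μ) * (μ A).toReal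
      = (∫ ω in A, f ω ∂μ) * (μ (A ∩ g ⁻¹' B)).toReal := by
  by_cases hA0 : μ A = 0
  · rw [Measure.restrict_eq_zero.2 hA0]
    simp [hA0]
  have hφ : Measurable (B.indicator (fun _ => (1 : ℝ))) := measurable_const.indicator hB
  have key := (h.comp measurable_id hφ).integral_fun_mul_eq_mul_integral
    hf.aestronglyMeasurable (hφ.comp hg).aestronglyMeasurable
  have hind : ∀ ω, B.indicator (fun _ => (1 : ℝ)) (g ω)
      = (g ⁻¹' B).indicator (fun _ => (1 : ℝ)) ω := fun ω => rfl
  have hmul : ∀ ω, f ω * (g ⁻¹' B).indicator (fun _ => (1 : ℝ)) ω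
      = (g ⁻¹' B).indicator f ω := fun ω => by
    by_cases hω : ω ∈ g ⁻¹' B <;> simp [hω]
  have hpos : (μ A).toReal ≠ 0 := (ENNReal.toReal_pos hA0 (measure_ne_top μ A)).ne'
  simp only [Function.comp_apply, id_eq, hind, hmul, ProbabilityTheory.cond,
    integral_smul_measure, setIntegral_indicator (hg hB), setIntegral_const, ENNReal.toReal_inv,
    smul_eq_mul, mul_one, Measure.real] at key
  field_simp at key
  linarith

lemma cExp_inter_preimage_of_indepFun
    {μ : Measure Ω} [IsFiniteMeasure μ] {f : Ω → ℝ} {g : Ω → β} {A : Set Ω} {B : Set β}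
    (h : IndepFun f g (μ[|A])) (hf : Measurable f) (hg : Measurable g)
    (hB : MeasurableSet B) (hpos : 0 < μ (A ∩ g ⁻¹' B)) :
    cExp μ f (A ∩ g ⁻¹' B) = cExp μ f A := by
  have hA : 0 < μ A := hpos.trans_le (measure_mono Set.inter_subset_left)
  have h1 := ENNReal.toReal_pos hpos.ne' (measure_ne_top μ _)
  have h2 := ENNReal.toReal_pos hA.ne' (measure_ne_top μ _)
  rw [cExp, cExp, div_eq_div_iff h1.ne' h2.ne']
  exact h.setIntegral_inter_preimage_mul hf hg hB

lemma cExp_eq_of_forall_inter_preimage [Countable β] [MeasurableSingletonClass β]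
    {μ : Measure Ω} [IsFiniteMeasure μ] {f : Ω → ℝ} {g : Ω → β} {S : Set Ω} {m : ℝ}
    (hg : Measurable g) (hS : MeasurableSet S) (hf : Integrable f μ) (hpos : 0 < μ S)
    (h : ∀ b, 0 < μ (S ∩ g ⁻¹' {b}) → cExp μ f (S ∩ g ⁻¹' {b}) = m) :
    cExp μ f S = m := by
  have h1 := ENNReal.toReal_pos hpos.ne' (measure_ne_top μ _)
  rw [cExp, div_eq_iff h1.ne']
  have hterm : ∀ b, ∫ ω in S ∩ g ⁻¹' {b}, f ω ∂μ = m * (μ (S ∩ g ⁻¹' {b})).toReal := fun b => by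
    rcases eq_zero_or_pos (μ (S ∩ g ⁻¹' {b})) with h0 | h0
    · rw [Measure.restrict_eq_zero.2 h0]
      simp [h0]
    · have h2 := ENNReal.toReal_pos h0.ne' (measure_ne_top μ _)
      rw [← h b h0, cExp, div_mul_cancel₀ _ h2.ne']
  have hsum := hasSum_setIntegral_inter_preimage hg hS hf
  simp only [hterm] at hsum
  exact hsum.unique ((hasSum_measure_inter_preimage hg hS).mul_left m)

lemma setIntegral_inter_mul_of_indepFun {γ : Type*} [MeasurableSpace γ]
    {μ : Measure Ω} [IsFiniteMeasure μ] {T : Ω → γ} {g : Ω → β} {A : Set Ω} {B : Set β}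
    {φ : γ → ℝ} {D : Set γ}
    (h : IndepFun T g (μ[|A])) (hT : Measurable T) (hg : Measurable g)
    (hB : MeasurableSet B) (hφ : Measurable φ) (hD : MeasurableSet D) :
    (∫ ω in A ∩ g ⁻¹' B ∩ T ⁻¹' D, φ (T ω) ∂μ) * (μ A).toReal
      = (∫ ω in A ∩ T ⁻¹' D, φ (T ω) ∂μ) * (μ (A ∩ g ⁻¹' B)).toReal := by
  have hψ : Measurable (D.indicator φ) := hφ.indicator hD
  have key := (h.comp hψ measurable_id).setIntegral_inter_preimage_mul (hψ.comp hT) hg hB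
  have hind : ∀ ω, (D.indicator φ ∘ T) ω = (T ⁻¹' D).indicator (fun ω => φ (T ω)) ω :=
    fun ω => rfl
  simpa only [hind, setIntegral_indicator (hT hD), Function.id_comp] using key

lemma measure_inter_mul_of_indepFun {γ : Type*} [MeasurableSpace γ]
    {μ : Measure Ω} [IsFiniteMeasure μ] {T : Ω → γ} {g : Ω → β} {A : Set Ω} {B : Set β}
    {D : Set γ}
    (h : IndepFun T g (μ[|A])) (hT : Measurable T) (hg : Measurable g)
    (hB : MeasurableSet B) (hD : MeasurableSet D) :
    (μ (A ∩ g ⁻¹' B ∩ T ⁻¹' D)).toReal * (μ A).toReal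
      = (μ (A ∩ T ⁻¹' D)).toReal * (μ (A ∩ g ⁻¹' B)).toReal := by
  simpa [Measure.real] using setIntegral_inter_mul_of_indepFun (φ := fun _ => (1 : ℝ)) h hT hg hB
    measurable_const hD

lemma cExp_inter_of_indepFun {γ : Type*} [MeasurableSpace γ]
    {μ : Measure Ω} [IsFiniteMeasure μ] {T : Ω → γ} {g : Ω → β} {A : Set Ω} {B : Set β}
    {φ : γ → ℝ} {D : Set γ}
    (h : IndepFun T g (μ[|A])) (hT : Measurable T) (hg : Measurable g)
    (hB : MeasurableSet B) (hφ : Measurable φ) (hD : MeasurableSet D)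
    (hpos : 0 < μ (A ∩ g ⁻¹' B ∩ T ⁻¹' D)) :
    cExp μ (fun ω => φ (T ω)) (A ∩ g ⁻¹' B ∩ T ⁻¹' D)
      = cExp μ (fun ω => φ (T ω)) (A ∩ T ⁻¹' D) := by
  have hAD : 0 < μ (A ∩ T ⁻¹' D) := hpos.trans_le (measure_mono fun ω hω => ⟨hω.1.1, hω.2⟩)
  have hA : 0 < μ A := hAD.trans_le (measure_mono Set.inter_subset_left)
  have h1 := ENNReal.toReal_pos hpos.ne' (measure_ne_top μ _)
  have h2 := ENNReal.toReal_pos hAD.ne' (measure_ne_top μ _)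
  have h3 := ENNReal.toReal_pos hA.ne' (measure_ne_top μ _)
  have hi := setIntegral_inter_mul_of_indepFun h hT hg hB hφ hD
  have hm := measure_inter_mul_of_indepFun h hT hg hB hD
  rw [cExp, cExp, div_eq_div_iff h1.ne' h2.ne']
  apply mul_right_cancel₀ h3.ne'
  linear_combination (μ (A ∩ T ⁻¹' D)).toReal * hi
    - (∫ ω in A ∩ T ⁻¹' D, φ (T ω) ∂μ) * hm

lemma cExp_congr {μ : Measure Ω} {f f' : Ω → ℝ} {S : Set Ω} (hS : MeasurableSet S)
    (h : Set.EqOn f f' S) : cExp μ f S = cExp μ f' S := by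
  rw [cExp, cExp, setIntegral_congr_fun hS h]

end Conditioning

/-- Identification of the principal causal effect `E[Y₁ − Y₀ | C=c]` under treatment
assignment ignorability and positivity (i), latent missing at random with response
positivity (ii), and principal ignorability (iii), with consistency
`Y = Z·Y₁ + (1 − Z)·Y₀`: the effect equals the ratio of
`Σ_x π_c(x)·(μ₁c(x) − κ₀(x))·P(X=x)` (over `x` with `P({X=x} ∩ {C=c}) > 0`) to
`Σ_x π_c(x)·P(X=x)` (over `x` with `P(X=x) > 0`), where
`π_c(x) = P(C=c | {X=x} ∩ {Z=1})`,
`μ₁c(x) = E[Y | {X=x} ∩ {Z=1} ∩ {C=c} ∩ {R=1}]`, and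
`κ₀(x) = E[Y | {X=x} ∩ {Z=0} ∩ {R=1}]`. -/
theorem stmt19 {Ω 𝒳 : Type*} [MeasurableSpace Ω]
    [Countable 𝒳] [MeasurableSpace 𝒳] [MeasurableSingletonClass 𝒳]
    (P : Measure Ω) [IsProbabilityMeasure P]
    (X : Ω → 𝒳) (Z C R : Ω → Fin 2) (Y₁ Y₀ : Ω → ℝ)
    (hX : Measurable X) (hZ : Measurable Z) (hC : Measurable C) (hR : Measurable R)
    (hY₁m : Measurable Y₁) (hY₀m : Measurable Y₀)
    (hY₁int : Integrable Y₁ P) (hY₀int : Integrable Y₀ P)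
    (Y : Ω → ℝ)
    (hYdef : Y = fun ω => ((Z ω : ℕ) : ℝ) * Y₁ ω + (1 - ((Z ω : ℕ) : ℝ)) * Y₀ ω)
    (c : Fin 2) (hc : 0 < P (C ⁻¹' {c}))
    (hTA : ∀ x : 𝒳, 0 < P (X ⁻¹' {x}) →
      IndepFun (fun ω => (Y₁ ω, Y₀ ω, C ω)) Z (P[|X ⁻¹' {x}])
      ∧ 0 < cPr P (Z ⁻¹' {1}) (X ⁻¹' {x}) ∧ cPr P (Z ⁻¹' {1}) (X ⁻¹' {x}) < 1)
    (hLMAR : ∀ x : 𝒳, 0 < P (X ⁻¹' {x}) → ∀ z c' : Fin 2,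
      0 < P (X ⁻¹' {x} ∩ Z ⁻¹' {z} ∩ C ⁻¹' {c'}) →
      IndepFun R Y (P[|X ⁻¹' {x} ∩ Z ⁻¹' {z} ∩ C ⁻¹' {c'}])
      ∧ 0 < cPr P (R ⁻¹' {1}) (X ⁻¹' {x} ∩ Z ⁻¹' {z} ∩ C ⁻¹' {c'}))
    (hPI : ∀ x : 𝒳, 0 < P (X ⁻¹' {x}) →
      (∀ c' : Fin 2, 0 < P (X ⁻¹' {x} ∩ Z ⁻¹' {0} ∩ C ⁻¹' {c'})) →
      cExp P Y (X ⁻¹' {x} ∩ Z ⁻¹' {0} ∩ C ⁻¹' {1})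
        = cExp P Y (X ⁻¹' {x} ∩ Z ⁻¹' {0} ∩ C ⁻¹' {0})) :
    cExp P (fun ω => Y₁ ω - Y₀ ω) (C ⁻¹' {c})
      = (∑' x : 𝒳, if 0 < P (X ⁻¹' {x} ∩ C ⁻¹' {c}) then
            cPr P (C ⁻¹' {c}) (X ⁻¹' {x} ∩ Z ⁻¹' {1})
            * (cExp P Y (X ⁻¹' {x} ∩ Z ⁻¹' {1} ∩ C ⁻¹' {c} ∩ R ⁻¹' {1})
               - cExp P Y (X ⁻¹' {x} ∩ Z ⁻¹' {0} ∩ R ⁻¹' {1}))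
            * (P (X ⁻¹' {x})).toReal else 0)
        / (∑' x : 𝒳, if 0 < P (X ⁻¹' {x}) then
            cPr P (C ⁻¹' {c}) (X ⁻¹' {x} ∩ Z ⁻¹' {1}) * (P (X ⁻¹' {x})).toReal else 0) := by
  have hsing : ∀ i : Fin 2, MeasurableSet ({i} : Set (Fin 2)) := measurableSet_singleton
  have hXm : ∀ x, MeasurableSet (X ⁻¹' {x}) := fun x => hX (measurableSet_singleton x)
  have hZm : ∀ z, MeasurableSet (Z ⁻¹' {z}) := fun z => hZ (hsing z)
  have hCm : ∀ k, MeasurableSet (C ⁻¹' {k}) := fun k => hC (hsing k)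
  have hRm : ∀ r, MeasurableSet (R ⁻¹' {r}) := fun r => hR (hsing r)
  have hZr : Measurable fun ω => ((Z ω : ℕ) : ℝ) :=
    (measurable_of_finite fun z : Fin 2 => ((z : ℕ) : ℝ)).comp hZ
  have hYm : Measurable Y := by
    rw [hYdef]
    fun_prop
  have hY1 : Set.EqOn Y Y₁ (Z ⁻¹' {1}) := fun ω hω => by
    have hz : Z ω = 1 := hω
    simp [hYdef, hz]
  have hY0 : Set.EqOn Y Y₀ (Z ⁻¹' {0}) := fun ω hω => by
    have hz : Z ω = 0 := hω
    simp [hYdef, hz]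
  have hYint : Integrable Y P := by
    refine (hY₁int.norm.add hY₀int.norm).mono' hYm.aestronglyMeasurable (.of_forall fun ω => ?_)
    rcases (by omega : Z ω = 0 ∨ Z ω = 1) with hz | hz
    · simp [hY0 hz]
    · simp [hY1 hz]
  set T : Ω → ℝ × ℝ × Fin 2 := fun ω => (Y₁ ω, Y₀ ω, C ω)
  have hT : Measurable T := by fun_prop
  have hD : ∀ k : Fin 2, MeasurableSet {t : ℝ × ℝ × Fin 2 | t.2.2 = k} := fun k =>
    (measurable_snd.comp measurable_snd) (hsing k)
  have hZpos : ∀ x, 0 < P (X ⁻¹' {x}) → ∀ z, 0 < (P (X ⁻¹' {x} ∩ Z ⁻¹' {z})).toReal := by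
    intro x hx
    obtain ⟨-, h0, h1⟩ := hTA x hx
    have hxr := ENNReal.toReal_pos hx.ne' (measure_ne_top P _)
    rw [cPr, Set.inter_comm] at h0 h1
    rw [div_lt_one hxr] at h1
    have hs := (hasSum_measure_inter_preimage (μ := P) hZ (hXm x)).unique (hasSum_fintype _)
    rw [Fin.sum_univ_two] at hs
    have h0' : 0 < (P (X ⁻¹' {x} ∩ Z ⁻¹' {1})).toReal := (div_pos_iff_of_pos_right hxr).1 h0
    rw [Fin.forall_fin_two]
    exact ⟨by linarith, h0'⟩
  have hmul : ∀ x, 0 < P (X ⁻¹' {x}) → ∀ z k,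
      (P (X ⁻¹' {x} ∩ Z ⁻¹' {z} ∩ C ⁻¹' {k})).toReal * (P (X ⁻¹' {x})).toReal
        = (P (X ⁻¹' {x} ∩ C ⁻¹' {k})).toReal * (P (X ⁻¹' {x} ∩ Z ⁻¹' {z})).toReal :=
    fun x hx z k => measure_inter_mul_of_indepFun (T := T) (D := {t | t.2.2 = k})
      (hTA x hx).1 hT hZ (hsing z) (hD k)
  have hπ : ∀ x, 0 < P (X ⁻¹' {x}) →
      cPr P (C ⁻¹' {c}) (X ⁻¹' {x} ∩ Z ⁻¹' {1}) * (P (X ⁻¹' {x})).toReal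
        = (P (X ⁻¹' {x} ∩ C ⁻¹' {c})).toReal := by
    intro x hx
    rw [cPr, Set.inter_comm, div_mul_eq_mul_div, div_eq_iff (hZpos x hx 1).ne']
    exact hmul x hx 1 c
  have hXCpos : ∀ x k, 0 < P (X ⁻¹' {x} ∩ C ⁻¹' {k}) → 0 < P (X ⁻¹' {x}) :=
    fun x k h => h.trans_le (measure_mono Set.inter_subset_left)
  have hXZCpos : ∀ x k, 0 < P (X ⁻¹' {x} ∩ C ⁻¹' {k}) → ∀ z,
      0 < P (X ⁻¹' {x} ∩ Z ⁻¹' {z} ∩ C ⁻¹' {k}) := by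
    intro x k h z
    have hx := hXCpos x k h
    have h1 := mul_pos (ENNReal.toReal_pos h.ne' (measure_ne_top P _)) (hZpos x hx z)
    rw [← hmul x hx z k] at h1
    exact (ENNReal.toReal_pos_iff.1 (pos_of_mul_pos_left h1 ENNReal.toReal_nonneg)).1
  have hRpos : ∀ x, 0 < P (X ⁻¹' {x}) → ∀ z k, 0 < P (X ⁻¹' {x} ∩ Z ⁻¹' {z} ∩ C ⁻¹' {k}) →
      0 < P (X ⁻¹' {x} ∩ Z ⁻¹' {z} ∩ C ⁻¹' {k} ∩ R ⁻¹' {1}) := by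
    intro x hx z k h
    have h1 := (hLMAR x hx z k h).2
    rw [cPr, Set.inter_comm,
      div_pos_iff_of_pos_right (ENNReal.toReal_pos h.ne' (measure_ne_top P _))] at h1
    exact (ENNReal.toReal_pos_iff.1 h1).1
  have hMAR : ∀ x, 0 < P (X ⁻¹' {x}) → ∀ z k, 0 < P (X ⁻¹' {x} ∩ Z ⁻¹' {z} ∩ C ⁻¹' {k}) →
      cExp P Y (X ⁻¹' {x} ∩ Z ⁻¹' {z} ∩ C ⁻¹' {k} ∩ R ⁻¹' {1})
        = cExp P Y (X ⁻¹' {x} ∩ Z ⁻¹' {z} ∩ C ⁻¹' {k}) := fun x hx z k h =>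
    cExp_inter_preimage_of_indepFun (hLMAR x hx z k h).1.symm hYm hR (hsing 1) (hRpos x hx z k h)
  have hμ : ∀ x, 0 < P (X ⁻¹' {x} ∩ C ⁻¹' {c}) →
      cExp P Y (X ⁻¹' {x} ∩ Z ⁻¹' {1} ∩ C ⁻¹' {c} ∩ R ⁻¹' {1})
        = cExp P Y₁ (X ⁻¹' {x} ∩ C ⁻¹' {c}) := by
    intro x h
    have hx := hXCpos x c h
    have hp := hXZCpos x c h 1
    rw [hMAR x hx 1 c hp, cExp_congr (((hXm x).inter (hZm 1)).inter (hCm c))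
      (hY1.mono fun ω hω => hω.1.2)]
    exact cExp_inter_of_indepFun (φ := fun t => t.1) (hTA x hx).1 hT hZ (hsing 1)
      measurable_fst (hD c) hp
  have hκ : ∀ x, 0 < P (X ⁻¹' {x} ∩ C ⁻¹' {c}) →
      cExp P Y (X ⁻¹' {x} ∩ Z ⁻¹' {0} ∩ R ⁻¹' {1}) = cExp P Y₀ (X ⁻¹' {x} ∩ C ⁻¹' {c}) := by
    intro x h
    have hx := hXCpos x c h
    have hp := hXZCpos x c h 0
    have hY₀ : cExp P Y₀ (X ⁻¹' {x} ∩ C ⁻¹' {c})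
        = cExp P Y (X ⁻¹' {x} ∩ Z ⁻¹' {0} ∩ C ⁻¹' {c}) := by
      rw [cExp_congr (((hXm x).inter (hZm 0)).inter (hCm c)) (hY0.mono fun ω hω => hω.1.2)]
      exact (cExp_inter_of_indepFun (φ := fun t => t.2.1) (hTA x hx).1 hT hZ (hsing 0)
        (by fun_prop) (hD c) hp).symm
    rw [hY₀]
    refine cExp_eq_of_forall_inter_preimage hC (((hXm x).inter (hZm 0)).inter (hRm 1)) hYint
      ((hRpos x hx 0 c hp).trans_le (measure_mono fun ω hω => ⟨hω.1.1, hω.2⟩)) fun k hk => ?_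
    rw [Set.inter_right_comm] at hk ⊢
    have hk' : 0 < P (X ⁻¹' {x} ∩ Z ⁻¹' {0} ∩ C ⁻¹' {k}) :=
      hk.trans_le (measure_mono Set.inter_subset_left)
    rw [hMAR x hx 0 k hk']
    by_cases hkc : k = c
    · rw [hkc]
    have hall : ∀ j : Fin 2, 0 < P (X ⁻¹' {x} ∩ Z ⁻¹' {0} ∩ C ⁻¹' {j}) := by
      intro j
      rcases (by omega : j = k ∨ j = c) with rfl | rfl
      · exact hk'
      · exact hp
    have hpi := hPI x hx hall
    rcases (by omega : (k = 0 ∧ c = 1) ∨ (k = 1 ∧ c = 0)) with ⟨rfl, rfl⟩ | ⟨rfl, rfl⟩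
    · exact hpi.symm
    · exact hpi
  have hnum := (hasSum_setIntegral_inter_preimage hX (hCm c) (hY₁int.sub hY₀int)).tsum_eq
  have hden := (hasSum_measure_inter_preimage (μ := P) hX (hCm c)).tsum_eq
  rw [cExp]
  congr 1
  · refine hnum.symm.trans (tsum_congr fun x => ?_)
    rw [Set.inter_comm]
    split_ifs with h
    · have hr := ENNReal.toReal_pos h.ne' (measure_ne_top P _)
      rw [mul_right_comm, hπ x (hXCpos x c h), hμ x h, hκ x h, cExp, cExp, ← sub_div,
        mul_div_cancel₀ _ hr.ne']
      exact integral_sub hY₁int.integrableOn hY₀int.integrableOn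
    · rw [Measure.restrict_eq_zero.2 (not_lt.1 h |>.antisymm zero_le)]
      simp
  · refine hden.symm.trans (tsum_congr fun x => ?_)
    rw [Set.inter_comm]
    split_ifs with h
    · exact (hπ x h).symm
    · rw [measure_mono_null Set.inter_subset_left (not_lt.1 h |>.antisymm zero_le)]
      simp
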